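/- arXiv:0704.2903 — 2 statements merged into one kernel-verified Lean document; each statement's English description precedes it below -/
import Mathlib

section
/- Let H be a finite-dimensional complex Hilbert space, let Q be a finite set, let A be a finite answer set, and for each q ∈ Q let {W_q^a}_{a∈A} be a projective measurement on H. Let ψ ∈ H ⊗ H be a unit vector invariant under swapping the two tensor factors, let π be a probability distribution on Q, and suppose Σ_{q,q'∈Q} π(q)π(q') Σ_{a,a'} ‖(W_q^{a} ⊗ W_{q'}^{a'} − W_{q'}^{a'} ⊗ W_q^{a})ψ‖² ≤ δ. Then Σ_{q∈Q} π(q) Σ_a ‖(W_q^{a} ⊗ Id − Id ⊗ W_q^{a})ψ‖² ≤ 9δ. -/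
open scoped Kronecker

/-- Squared ℓ²-norm of a vector in a finite-dimensional complex Hilbert space. -/
noncomputable def nsq {ι : Type*} [Fintype ι] (v : ι → ℂ) : ℝ := ∑ i, ‖v i‖ ^ 2

/-- A projective measurement with outcome set `A`: a family of orthogonal projections
summing to the identity. -/
def IsProjMeas {n : Type*} [Fintype n] [DecidableEq n] {A : Type*} [Fintype A]
    (W : A → Matrix n n ℂ) : Prop :=
  (∀ a, (W a).IsHermitian) ∧ (∀ a, W a * W a = W a) ∧ (∑ a, W a) = 1

open Matrix in
theorem nsq_mulVec {ι : Type*} [Fintype ι] (X : Matrix ι ι ℂ) (v : ι → ℂ) :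
    nsq (X.mulVec v) = (star v ⬝ᵥ (Xᴴ * X).mulVec v).re := by
  rw [← mulVec_mulVec, dotProduct_mulVec, ← star_mulVec]
  simp only [nsq, dotProduct, Pi.star_apply, Complex.re_sum]
  refine Finset.sum_congr rfl fun i _ => ?_
  rw [← Complex.normSq_eq_norm_sq, Complex.normSq_apply]
  simp

theorem nsq_nonneg {ι : Type*} [Fintype ι] (v : ι → ℂ) : 0 ≤ nsq v :=
  Finset.sum_nonneg fun _ _ => by positivity

theorem nsq_neg {ι : Type*} [Fintype ι] (v : ι → ℂ) : nsq (-v) = nsq v := by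
  simp [nsq]

theorem nsq_add_add_le {ι : Type*} [Fintype ι] (x y z : ι → ℂ) :
    nsq (x + y + z) ≤ 3 * (nsq x + nsq y + nsq z) := by
  simp only [nsq, ← Finset.sum_add_distrib, Finset.mul_sum]
  refine Finset.sum_le_sum fun i _ => ?_
  have h : ‖(x + y + z) i‖ ≤ ‖x i‖ + ‖y i‖ + ‖z i‖ := norm_add₃_le
  have h2 := pow_le_pow_left₀ (norm_nonneg _) h 2
  nlinarith [sq_nonneg (‖x i‖ - ‖y i‖), sq_nonneg (‖x i‖ - ‖z i‖), sq_nonneg (‖y i‖ - ‖z i‖)]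

theorem sum_nsq_mulVec {ι κ : Type*} [Fintype ι] [Fintype κ] (X : κ → Matrix ι ι ℂ)
    (v : ι → ℂ) :
    ∑ k, nsq ((X k).mulVec v)
      = (star v ⬝ᵥ (∑ k, (X k).conjTranspose * X k).mulVec v).re := by
  simp only [nsq_mulVec, Matrix.sum_mulVec, dotProduct_sum, Complex.re_sum]

theorem IsProjMeas.sum_nsq {n A : Type*} [Fintype n] [DecidableEq n] [Fintype A]
    {W : A → Matrix n n ℂ} (hW : IsProjMeas W) (v : n → ℂ) :
    ∑ a, nsq ((W a).mulVec v) = nsq v := by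
  have h : ∀ a, (W a).conjTranspose * W a = W a := fun a => by rw [(hW.1 a).eq, hW.2.1 a]
  rw [sum_nsq_mulVec]
  simp only [h, hW.2.2]
  simpa using (nsq_mulVec (1 : Matrix n n ℂ) v).symm

theorem IsProjMeas.nsq_le {n A : Type*} [Fintype n] [DecidableEq n] [Fintype A]
    {W : A → Matrix n n ℂ} (hW : IsProjMeas W) (a : A) (v : n → ℂ) :
    nsq ((W a).mulVec v) ≤ nsq v := by
  rw [← hW.sum_nsq v]
  exact Finset.single_le_sum (f := fun a => nsq ((W a).mulVec v))
    (fun _ _ => nsq_nonneg _) (Finset.mem_univ a)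

theorem IsProjMeas.kronecker_one {n m A : Type*} [Fintype n] [DecidableEq n] [Fintype m]
    [DecidableEq m] [Fintype A] {W : A → Matrix n n ℂ} (hW : IsProjMeas W) :
    IsProjMeas fun a => W a ⊗ₖ (1 : Matrix m m ℂ) := by
  refine ⟨fun a => ?_, fun a => ?_, ?_⟩
  · rw [Matrix.IsHermitian, Matrix.conjTranspose_kronecker, (hW.1 a).eq,
      Matrix.conjTranspose_one]
  · rw [← Matrix.mul_kronecker_mul, hW.2.1, one_mul]
  · rw [← Matrix.one_kronecker_one, ← hW.2.2]
    ext i j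
    simp [Matrix.sum_apply, Finset.sum_mul]

theorem IsProjMeas.one_kronecker {n m A : Type*} [Fintype n] [DecidableEq n] [Fintype m]
    [DecidableEq m] [Fintype A] {W : A → Matrix n n ℂ} (hW : IsProjMeas W) :
    IsProjMeas fun a => (1 : Matrix m m ℂ) ⊗ₖ W a := by
  refine ⟨fun a => ?_, fun a => ?_, ?_⟩
  · rw [Matrix.IsHermitian, Matrix.conjTranspose_kronecker, (hW.1 a).eq,
      Matrix.conjTranspose_one]
  · rw [← Matrix.mul_kronecker_mul, hW.2.1, one_mul]
  · rw [← Matrix.one_kronecker_one, ← hW.2.2]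
    ext i j
    simp [Matrix.sum_apply, Finset.mul_sum]

section Commuting

variable {n A B : Type*} [Fintype n] [DecidableEq n] [Fintype A] [Fintype B]
  {w w' : A → Matrix n n ℂ} {v v' : B → Matrix n n ℂ}

/-- For measurements `w, v` commuting with `w', v'`, the defect of exchanging the two pairs
equals the defect between the products `w v` and `w' v'`. -/
theorem sum_nsq_mul_sub_mul_eq (hw : IsProjMeas w) (hw' : IsProjMeas w')
    (hv : IsProjMeas v) (hv' : IsProjMeas v')
    (hww : ∀ a b, Commute (w a) (w' b)) (hwv : ∀ a c, Commute (w a) (v' c))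
    (hvw : ∀ c a, Commute (v c) (w' a)) (ψ : n → ℂ) :
    ∑ a, ∑ c, nsq ((w a * v c - w' a * v' c).mulVec ψ)
      = ∑ a, ∑ c, nsq ((w a * v' c - v c * w' a).mulVec ψ) := by
  have hL : ∀ a c, (w a * v c - w' a * v' c).conjTranspose * (w a * v c - w' a * v' c)
      = v c * w a * v c + v' c * w' a * v' c
        - (v c * w a * (w' a * v' c) + v' c * w' a * (w a * v c)) := fun a c => by
    simp only [Matrix.conjTranspose_sub, Matrix.conjTranspose_mul, (hw.1 a).eq, (hw'.1 a).eq,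
      (hv.1 c).eq, (hv'.1 c).eq]
    have h1 : v c * w a * (w a * v c) = v c * w a * v c := by
      rw [← mul_assoc, mul_assoc (v c), hw.2.1]
    have h2 : v' c * w' a * (w' a * v' c) = v' c * w' a * v' c := by
      rw [← mul_assoc, mul_assoc (v' c), hw'.2.1]
    rw [sub_mul, mul_sub, mul_sub, h1, h2]
    abel
  have hR : ∀ a c, (w a * v' c - v c * w' a).conjTranspose * (w a * v' c - v c * w' a)
      = w a * v' c + v c * w' a
        - (v c * w a * (w' a * v' c) + v' c * w' a * (w a * v c)) := fun a c => by
    simp only [Matrix.conjTranspose_sub, Matrix.conjTranspose_mul, (hw.1 a).eq, (hw'.1 a).eq,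
      (hv.1 c).eq, (hv'.1 c).eq]
    have h1 : v' c * w a * (w a * v' c) = w a * v' c := by
      rw [← mul_assoc, mul_assoc (v' c), hw.2.1, ← (hwv a c).eq, mul_assoc, hv'.2.1]
    have h2 : w' a * v c * (v c * w' a) = v c * w' a := by
      rw [← mul_assoc, mul_assoc (w' a), hv.2.1, ← (hvw c a).eq, mul_assoc, hw'.2.1]
    have h3 : v' c * w a * (v c * w' a) = v' c * w' a * (w a * v c) := by
      rw [(hvw c a).eq, mul_assoc, ← mul_assoc (w a), (hww a a).eq]
      simp only [mul_assoc]
    have h4 : w' a * v c * (w a * v' c) = v c * w a * (w' a * v' c) := by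
      rw [← (hvw c a).eq, mul_assoc, ← mul_assoc (w' a), ← (hww a a).eq]
      simp only [mul_assoc]
    rw [sub_mul, mul_sub, mul_sub, h1, h2, h3, h4]
    abel
  have hsum : ∑ a, ∑ c, (v c * w a * v c + v' c * w' a * v' c)
      = ∑ a, ∑ c, (w a * v' c + v c * w' a) := by
    have h1 : ∑ a, ∑ c, v c * w a * v c = 1 := by
      rw [Finset.sum_comm]
      simp only [← Finset.sum_mul, ← Finset.mul_sum, hw.2.2, mul_one, hv.2.1, hv.2.2]
    have h2 : ∑ a, ∑ c, v' c * w' a * v' c = 1 := by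
      rw [Finset.sum_comm]
      simp only [← Finset.sum_mul, ← Finset.mul_sum, hw'.2.2, mul_one, hv'.2.1, hv'.2.2]
    have h3 : ∑ a, ∑ c, w a * v' c = 1 := by
      simp only [← Finset.mul_sum, hv'.2.2, mul_one, hw.2.2]
    have h4 : ∑ a, ∑ c, v c * w' a = 1 := by
      simp only [← Finset.sum_mul, hv.2.2, one_mul, hw'.2.2]
    simp only [Finset.sum_add_distrib, h1, h2, h3, h4]
  simp only [sum_nsq_mulVec, hL, hR, ← Complex.re_sum, ← dotProduct_sum, ← Matrix.sum_mulVec]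
  simp only [Finset.sum_sub_distrib _ _, hsum]

theorem sum_nsq_sub_le (hw : IsProjMeas w) (hw' : IsProjMeas w')
    (hv : IsProjMeas v) (hv' : IsProjMeas v')
    (hww : ∀ a b, Commute (w a) (w' b)) (hwv : ∀ a c, Commute (w a) (v' c))
    (hvw : ∀ c a, Commute (v c) (w' a)) (ψ : n → ℂ) :
    ∑ c, nsq ((v c - v' c).mulVec ψ)
      ≤ 9 * ∑ a, ∑ c, nsq ((w a * v' c - v c * w' a).mulVec ψ) := by
  have hsplit : ∀ a c, nsq ((w a).mulVec ((v c - v' c).mulVec ψ))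
      ≤ 3 * (nsq ((w a * v c - w' a * v' c).mulVec ψ)
          + nsq ((w a * v c - w' a * v' c).mulVec ψ)
          + nsq ((w a * v' c - v c * w' a).mulVec ψ)) := fun a c => by
    have hmat : w a * (v c - v' c) = (w a * v c - w' a * v' c)
        + w' a * -(w a * v c - w' a * v' c) + w a * -(w a * v' c - v c * w' a) := by
      have h1 : w' a * (w a * v c) = w a * (v c * w' a) := by
        rw [← mul_assoc, ← (hww a a).eq, mul_assoc, (hvw c a).eq]
      have h2 : w' a * (w' a * v' c) = w' a * v' c := by rw [← mul_assoc, hw'.2.1]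
      have h3 : w a * (w a * v' c) = w a * v' c := by rw [← mul_assoc, hw.2.1]
      simp only [neg_sub, mul_sub, h1, h2, h3]
      abel
    rw [Matrix.mulVec_mulVec, hmat, Matrix.add_mulVec, Matrix.add_mulVec]
    refine (nsq_add_add_le _ _ _).trans ?_
    rw [← Matrix.mulVec_mulVec, ← Matrix.mulVec_mulVec]
    have h1 := hw'.nsq_le a ((-(w a * v c - w' a * v' c)).mulVec ψ)
    have h2 := hw.nsq_le a ((-(w a * v' c - v c * w' a)).mulVec ψ)
    rw [Matrix.neg_mulVec, nsq_neg] at h1 h2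
    simp only [Matrix.neg_mulVec]
    linarith
  calc ∑ c, nsq ((v c - v' c).mulVec ψ)
      = ∑ a, ∑ c, nsq ((w a).mulVec ((v c - v' c).mulVec ψ)) := by
        rw [Finset.sum_comm]
        exact Finset.sum_congr rfl fun c _ => (hw.sum_nsq _).symm
    _ ≤ _ := Finset.sum_le_sum fun a _ => Finset.sum_le_sum fun c _ => hsplit a c
    _ = 9 * ∑ a, ∑ c, nsq ((w a * v' c - v c * w' a).mulVec ψ) := by
        simp only [← Finset.mul_sum, Finset.sum_add_distrib,
          sum_nsq_mul_sub_mul_eq hw hw' hv hv' hww hwv hvw ψ]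
        ring

end Commuting

theorem commute_kronecker_one_one_kronecker {n m : Type*} [Fintype n] [DecidableEq n]
    [Fintype m] [DecidableEq m] (X : Matrix n n ℂ) (Y : Matrix m m ℂ) :
    Commute (X ⊗ₖ (1 : Matrix m m ℂ)) ((1 : Matrix n n ℂ) ⊗ₖ Y) := by
  simp only [Commute, SemiconjBy, ← Matrix.mul_kronecker_mul, one_mul, mul_one]

theorem IsProjMeas.sum_nsq_kronecker_sub_le {n A B : Type*} [Fintype n] [DecidableEq n]
    [Fintype A] [Fintype B] {W : A → Matrix n n ℂ} {V : B → Matrix n n ℂ}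
    (hW : IsProjMeas W) (hV : IsProjMeas V) (ψ : n × n → ℂ) :
    ∑ c, nsq ((V c ⊗ₖ (1 : Matrix n n ℂ) - (1 : Matrix n n ℂ) ⊗ₖ V c).mulVec ψ)
      ≤ 9 * ∑ a, ∑ c, nsq ((W a ⊗ₖ V c - V c ⊗ₖ W a).mulVec ψ) := by
  have h := sum_nsq_sub_le (hW.kronecker_one (m := n)) (hW.one_kronecker (m := n))
    (hV.kronecker_one (m := n)) (hV.one_kronecker (m := n))
    (fun _ _ => commute_kronecker_one_one_kronecker _ _)
    (fun _ _ => commute_kronecker_one_one_kronecker _ _)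
    (fun _ _ => commute_kronecker_one_one_kronecker _ _) ψ
  simpa only [← Matrix.mul_kronecker_mul, one_mul, mul_one] using h

theorem stmt1 {d : ℕ} {Q A : Type*} [Fintype Q] [Fintype A]
    (W : Q → A → Matrix (Fin d) (Fin d) ℂ)
    (hW : ∀ q, IsProjMeas (W q))
    (ψ : Fin d × Fin d → ℂ)
    (hunit : nsq ψ = 1)
    (hsym : ∀ i j, ψ (i, j) = ψ (j, i))
    (π : Q → ℝ) (hπ0 : ∀ q, 0 ≤ π q) (hπ1 : ∑ q, π q = 1)
    (δ : ℝ)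
    (hcomm : ∑ q, ∑ q', π q * π q' *
        ∑ a, ∑ a', nsq ((W q a ⊗ₖ W q' a' - W q' a' ⊗ₖ W q a).mulVec ψ) ≤ δ) :
    ∑ q, π q * ∑ a,
        nsq ((W q a ⊗ₖ (1 : Matrix (Fin d) (Fin d) ℂ)
          - (1 : Matrix (Fin d) (Fin d) ℂ) ⊗ₖ W q a).mulVec ψ) ≤ 9 * δ := by
  refine le_trans ?_ (mul_le_mul_of_nonneg_left hcomm (by norm_num))
  rw [Finset.sum_comm, Finset.mul_sum]
  refine Finset.sum_le_sum fun q' _ => ?_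
  set G := ∑ a, nsq ((W q' a ⊗ₖ (1 : Matrix (Fin d) (Fin d) ℂ)
    - (1 : Matrix (Fin d) (Fin d) ℂ) ⊗ₖ W q' a).mulVec ψ) with hG
  calc π q' * G = ∑ q, π q * π q' * G := by rw [← Finset.sum_mul, ← Finset.sum_mul, hπ1, one_mul]
    _ ≤ _ := by
      rw [Finset.mul_sum]
      refine Finset.sum_le_sum fun q _ => ?_
      have h := mul_le_mul_of_nonneg_left ((hW q).sum_nsq_kronecker_sub_le (hW q') ψ)
        (mul_nonneg (hπ0 q) (hπ0 q'))
      rw [← hG] at h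
      linarith
end

section
/- Let G = (N, π, V) be an N-prover one-round classical game with question set Q and answer set A, where π is a probability distribution on Q^N that is symmetric under permutations of its first k coordinates (k ≤ N), and V(a_1,…,a_N | q_1,…,q_N) is invariant under simultaneously applying any permutation of {1,…,k} to the first k answers and the first k questions. Suppose finite-dimensional complex Hilbert spaces H_1,…,H_N, a unit vector ψ ∈ H_1 ⊗ ⋯ ⊗ H_N, and projective measurements {(P_i)_q^a}_{a∈A} on H_i for each i and q achieve winning probability p = Σ_{q⃗} π(q⃗) Σ_{a⃗} V(a⃗|q⃗) ⟨ψ| (P_1)_{q_1}^{a_1} ⊗ ⋯ ⊗ (P_N)_{q_N}^{a_N} |ψ⟩. Then there exist finite-dimensional Hilbert spaces H'_1 = ⋯ = H'_k, H'_{k+1}, …, H'_N, a unit vector ψ' ∈ H'_1 ⊗ ⋯ ⊗ H'_N invariant under all permutations of the first k tensor factors, and projective measurements {(P'_i)_q^a} with (P'_1)_q^a = ⋯ = (P'_k)_q^a for all q, a, achieving the same winning probability p. -/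
/-- The winning probability of an entangled strategy
`(d, ψ, P)` in the `N`-prover one-round classical game `(π, V)`:
`Σ_q π(q) Σ_a V(a|q) ⟨ψ| (P_1)_{q_1}^{a_1} ⊗ ⋯ ⊗ (P_N)_{q_N}^{a_N} |ψ⟩`. -/
noncomputable def winProb {N : ℕ} {Q A : Type*} [Fintype Q] [Fintype A]
    (π : (Fin N → Q) → ℝ) (V : (Fin N → A) → (Fin N → Q) → Bool)
    (d : Fin N → ℕ) (ψ : (∀ i, Fin (d i)) → ℂ)
    (P : (i : Fin N) → Q → A → Matrix (Fin (d i)) (Fin (d i)) ℂ) : ℝ :=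
  ∑ q, π q * ∑ a, (if V a q then (1 : ℝ) else 0) *
    (∑ p : ∀ i, Fin (d i), ∑ p' : ∀ i, Fin (d i),
      (starRingEnd ℂ) (ψ p) * (∏ i, P i (q i) (a i) (p i) (p' i)) * ψ p').re

open Finset Matrix

/-- The matrix element `⟨ψ| M_1 ⊗ ⋯ ⊗ M_N |ψ⟩`. -/
noncomputable def tensorForm {ι : Type*} [Fintype ι] [DecidableEq ι] {T : ι → Type*}
    [∀ i, Fintype (T i)] (ψ : (∀ i, T i) → ℂ) (M : ∀ i, Matrix (T i) (T i) ℂ) : ℂ :=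
  ∑ p, ∑ p', (starRingEnd ℂ) (ψ p) * (∏ i, M i (p i) (p' i)) * ψ p'

theorem tensorForm_one {ι : Type*} [Fintype ι] [DecidableEq ι] {T : ι → Type*}
    [∀ i, Fintype (T i)] [∀ i, DecidableEq (T i)] (ψ : (∀ i, T i) → ℂ) :
    tensorForm ψ (fun _ => 1) = (nsq ψ : ℂ) := by
  have h (p p' : ∀ i, T i) :
      (∏ i, (1 : Matrix (T i) (T i) ℂ) (p i) (p' i)) = if p = p' then 1 else 0 := by
    simp only [Matrix.one_apply, Finset.prod_ite_zero, Finset.prod_const_one, Finset.mem_univ,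
      true_imp_iff, funext_iff]
  simp only [tensorForm, nsq, h, mul_ite, mul_one, mul_zero, ite_mul, zero_mul,
    Finset.sum_ite_eq, Finset.mem_univ, if_true, Complex.conj_mul']
  push_cast
  rfl

theorem tensorForm_submatrix {ι : Type*} [Fintype ι] [DecidableEq ι] {S T : Type*}
    [Fintype S] [Fintype T] (e : T ≃ S) (ψ : (ι → S) → ℂ) (M : ι → Matrix S S ℂ) :
    tensorForm (fun y : ι → T => ψ (fun i => e (y i))) (fun i => (M i).submatrix e e)
      = tensorForm ψ M := by
  unfold tensorForm
  refine Fintype.sum_equiv (Equiv.piCongrRight fun _ => e) _ _ fun x => ?_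
  exact Fintype.sum_equiv (Equiv.piCongrRight fun _ => e) _ _ fun y => rfl

/-- Extension by zero of a vector of `⨂ H_i` to `⨂ (⨁ H_j)`, where the `i`-th factor is
placed in the `i`-th summand. -/
noncomputable def diagEmbed {ι : Type*} [Fintype ι] [DecidableEq ι] {T : ι → Type*}
    [∀ i, Fintype (T i)] [∀ i, DecidableEq (T i)] (ψ : (∀ i, T i) → ℂ)
    (x : ι → Σ i, T i) : ℂ :=
  ∑ p : ∀ i, T i, if x = (fun i => ⟨i, p i⟩) then ψ p else 0

theorem fst_eq_of_diagEmbed_ne_zero {ι : Type*} [Fintype ι] [DecidableEq ι] {T : ι → Type*}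
    [∀ i, Fintype (T i)] [∀ i, DecidableEq (T i)] {ψ : (∀ i, T i) → ℂ}
    {x : ι → Σ i, T i} (h : diagEmbed ψ x ≠ 0) (i : ι) : (x i).1 = i := by
  obtain ⟨p, -, hp⟩ := Finset.exists_ne_zero_of_sum_ne_zero h
  have hx : x = fun i => ⟨i, p i⟩ := by
    by_contra hne
    exact hp (if_neg hne)
  rw [hx]

theorem tensorForm_diagEmbed {ι : Type*} [Fintype ι] [DecidableEq ι] {T : ι → Type*}
    [∀ i, Fintype (T i)] [∀ i, DecidableEq (T i)] (ψ : (∀ i, T i) → ℂ)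
    (M : ι → Matrix (Σ i, T i) (Σ i, T i) ℂ) :
    tensorForm (diagEmbed ψ) M
      = tensorForm ψ (fun i => (M i).submatrix (Sigma.mk i) (Sigma.mk i)) := by
  have h1 (f : (ι → Σ i, T i) → ℂ) :
      ∑ x, f x * diagEmbed ψ x = ∑ p : ∀ i, T i, f (fun i => ⟨i, p i⟩) * ψ p := by
    simp only [diagEmbed, Finset.mul_sum]
    rw [Finset.sum_comm]
    simp
  have h2 (f : (ι → Σ i, T i) → ℂ) :
      ∑ x, (starRingEnd ℂ) (diagEmbed ψ x) * f x
        = ∑ p : ∀ i, T i, (starRingEnd ℂ) (ψ p) * f (fun i => ⟨i, p i⟩) := by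
    simp only [diagEmbed, map_sum, Finset.sum_mul, apply_ite (starRingEnd ℂ), map_zero]
    rw [Finset.sum_comm]
    simp
  unfold tensorForm
  simp only [h1]
  simp only [mul_assoc, ← Finset.mul_sum]
  rw [h2]
  rfl

theorem arrowCongr_symm_refl_apply {ι X : Type*} (σ : Equiv.Perm ι) (z : ι → X) :
    (σ.symm.arrowCongr (Equiv.refl X)) z = z ∘ σ := by
  ext i : 1
  simp

/-- Distinct permutations of an embedded vector have orthogonal supports, also after applying
block-diagonal operators, so all cross terms of the symmetrized vector vanish. -/
theorem tensorForm_symmetrize {ι : Type*} [Fintype ι] [DecidableEq ι] {T : ι → Type*}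
    [∀ i, Fintype (T i)] [∀ i, DecidableEq (T i)] (K : Finset (Equiv.Perm ι))
    (c : ℂ) (ψ : (∀ i, T i) → ℂ)
    (M : ι → Matrix (Σ i, T i) (Σ i, T i) ℂ) (hM : ∀ i s t, s.1 ≠ t.1 → M i s t = 0) :
    tensorForm (fun x => c * ∑ σ ∈ K, diagEmbed ψ (x ∘ σ)) M
      = (starRingEnd ℂ) c * c * ∑ σ ∈ K, tensorForm (diagEmbed ψ) (fun i => M (σ i)) := by
  have key (x y : ι → Σ i, T i) (σ τ : Equiv.Perm ι) (hne : σ ≠ τ) :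
      (starRingEnd ℂ) (diagEmbed ψ (x ∘ σ)) * (∏ i, M i (x i) (y i)) * diagEmbed ψ (y ∘ τ)
        = 0 := by
    by_contra h
    have hx : diagEmbed ψ (x ∘ σ) ≠ 0 := fun h0 => h (by simp [h0])
    have hy : diagEmbed ψ (y ∘ τ) ≠ 0 := fun h0 => h (by simp [h0])
    have hxy (i : ι) : (x i).1 = (y i).1 := by
      by_contra hi
      exact h (by rw [Finset.prod_eq_zero (Finset.mem_univ i) (hM i _ _ hi)]; simp)
    refine hne (Equiv.ext fun i => ?_)
    have h1 := fst_eq_of_diagEmbed_ne_zero hx i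
    have h2 := fst_eq_of_diagEmbed_ne_zero hy (τ.symm (σ i))
    simp only [Function.comp_apply, Equiv.apply_symm_apply] at h1 h2
    rw [← hxy, h1, Equiv.eq_symm_apply] at h2
    exact h2.symm
  have hpt (x y : ι → Σ i, T i) :
      (starRingEnd ℂ) (c * ∑ σ ∈ K, diagEmbed ψ (x ∘ σ)) * (∏ i, M i (x i) (y i))
          * (c * ∑ σ ∈ K, diagEmbed ψ (y ∘ σ))
        = (starRingEnd ℂ) c * c * ∑ σ ∈ K, (starRingEnd ℂ) (diagEmbed ψ (x ∘ σ))
            * (∏ i, M i (x i) (y i)) * diagEmbed ψ (y ∘ σ) := by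
    have hdiag : ∑ σ ∈ K, (starRingEnd ℂ) (diagEmbed ψ (x ∘ σ))
            * (∏ i, M i (x i) (y i)) * diagEmbed ψ (y ∘ σ)
        = (∑ σ ∈ K, (starRingEnd ℂ) (diagEmbed ψ (x ∘ σ))) * (∏ i, M i (x i) (y i))
            * ∑ σ ∈ K, diagEmbed ψ (y ∘ σ) := by
      simp only [Finset.sum_mul, Finset.mul_sum]
      refine Finset.sum_congr rfl fun σ hσ => ?_
      rw [Finset.sum_eq_single_of_mem σ hσ fun τ _ hτ => key x y _ _ hτ]
    rw [hdiag, map_mul, map_sum]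
    ring
  have hperm (σ : Equiv.Perm ι) :
      ∑ x : ι → Σ i, T i, ∑ y : ι → Σ i, T i, (starRingEnd ℂ) (diagEmbed ψ (x ∘ σ))
          * (∏ i, M i (x i) (y i)) * diagEmbed ψ (y ∘ σ)
        = tensorForm (diagEmbed ψ) (fun i => M (σ i)) := by
    unfold tensorForm
    refine Fintype.sum_equiv (σ.symm.arrowCongr (Equiv.refl _)) _ _ fun x => ?_
    refine Fintype.sum_equiv (σ.symm.arrowCongr (Equiv.refl _)) _ _ fun y => ?_
    rw [arrowCongr_symm_refl_apply, arrowCongr_symm_refl_apply]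
    congr 2
    exact (Equiv.prod_comp σ fun i => M i (x i) (y i)).symm
  have hexp : tensorForm (fun x => c * ∑ σ ∈ K, diagEmbed ψ (x ∘ σ)) M
      = ∑ x : ι → Σ i, T i, ∑ y : ι → Σ i, T i, (starRingEnd ℂ) c * c *
          ∑ σ ∈ K, (starRingEnd ℂ) (diagEmbed ψ (x ∘ σ))
            * (∏ i, M i (x i) (y i)) * diagEmbed ψ (y ∘ σ) :=
    Finset.sum_congr rfl fun x _ => Finset.sum_congr rfl fun y _ => hpt x y
  rw [hexp]
  simp only [← Finset.mul_sum]
  congr 1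
  simp only [← hperm]
  rw [Finset.sum_comm]
  simp only [Finset.sum_comm (s := K)]
  rw [Finset.sum_comm]

theorem IsProjMeas.submatrix_blockDiagonal' {ι : Type*} [Fintype ι] [DecidableEq ι]
    {T : ι → Type*} [∀ i, Fintype (T i)] [∀ i, DecidableEq (T i)] {A : Type*} [Fintype A]
    {n : Type*} [Fintype n] [DecidableEq n] (e : n ≃ Σ i, T i)
    {W : ∀ i, A → Matrix (T i) (T i) ℂ} (hW : ∀ i, IsProjMeas (W i)) :
    IsProjMeas fun a => (blockDiagonal' fun i => W i a).submatrix e e := by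
  refine ⟨fun a => ?_, fun a => ?_, ?_⟩
  · rw [Matrix.IsHermitian, conjTranspose_submatrix, blockDiagonal'_conjTranspose]
    simp only [((hW _).1 a).eq]
  · rw [submatrix_mul_equiv, ← blockDiagonal'_mul]
    simp only [(hW _).2.1 a]
  · have hsum : ∑ a, blockDiagonal' (fun i => W i a)
        = (1 : Matrix (Σ i, T i) (Σ i, T i) ℂ) := by
      rw [← blockDiagonal'_one]
      refine (map_sum (blockDiagonal'AddMonoidHom T T ℂ) (fun a i => W i a) univ).symm.trans ?_
      change blockDiagonal' _ = _
      congr 1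
      ext1 i
      rw [Finset.sum_apply, (hW i).2.2]
      rfl
    rw [← submatrix_one_equiv e, ← hsum]
    ext s t
    simp [Matrix.sum_apply]

theorem winProb_eq {N : ℕ} {Q A : Type*} [Fintype Q] [Fintype A]
    (π : (Fin N → Q) → ℝ) (V : (Fin N → A) → (Fin N → Q) → Bool)
    (d : Fin N → ℕ) (ψ : (∀ i, Fin (d i)) → ℂ)
    (P : (i : Fin N) → Q → A → Matrix (Fin (d i)) (Fin (d i)) ℂ) :
    winProb π V d ψ P = ∑ q, π q * ∑ a, (if V a q then (1 : ℝ) else 0) *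
      (tensorForm ψ fun i => P i (q i) (a i)).re := rfl

theorem stmt10 {N : ℕ} {Q A : Type*} [Fintype Q] [Fintype A]
    (k : ℕ) (hk : k ≤ N)
    (π : (Fin N → Q) → ℝ)
    (hπ0 : ∀ q, 0 ≤ π q) (hπ1 : ∑ q, π q = 1)
    -- π is symmetric under permutations of its first k coordinates
    (hπsym : ∀ σ : Equiv.Perm (Fin N), (∀ i : Fin N, k ≤ (i : ℕ) → σ i = i) →
      ∀ q, π (q ∘ σ) = π q)
    (V : (Fin N → A) → (Fin N → Q) → Bool)
    -- V is invariant under simultaneous permutations of the first k answers and questions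
    (hVsym : ∀ σ : Equiv.Perm (Fin N), (∀ i : Fin N, k ≤ (i : ℕ) → σ i = i) →
      ∀ a q, V (a ∘ σ) (q ∘ σ) = V a q)
    -- a strategy achieving winning probability p
    (d : Fin N → ℕ) (ψ : (∀ i, Fin (d i)) → ℂ) (hψ : nsq ψ = 1)
    (P : (i : Fin N) → Q → A → Matrix (Fin (d i)) (Fin (d i)) ℂ)
    (hP : ∀ i q, IsProjMeas (P i q))
    (p : ℝ) (hp : winProb π V d ψ P = p) :
    -- there is a symmetrized strategy achieving the same winning probability
    ∃ (d' : Fin N → ℕ) (ψ' : (∀ i, Fin (d' i)) → ℂ)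
      (P' : (i : Fin N) → Q → A → Matrix (Fin (d' i)) (Fin (d' i)) ℂ),
      nsq ψ' = 1 ∧
      (∀ i q, IsProjMeas (P' i q)) ∧
      -- the first k Hilbert spaces are equal
      (∀ i j : Fin N, (i : ℕ) < k → (j : ℕ) < k → d' i = d' j) ∧
      -- the first k provers use the same measurements
      (∀ i j : Fin N, (i : ℕ) < k → (j : ℕ) < k → ∀ (h : d' i = d' j) (q : Q) (a : A),
        P' j q a = (P' i q a).submatrix (Fin.cast h.symm) (Fin.cast h.symm)) ∧
      -- ψ' is symmetric with respect to the first k tensor factors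
      (∀ σ : Equiv.Perm (Fin N), (∀ i : Fin N, k ≤ (i : ℕ) → σ i = i) →
        ∀ (hc : ∀ i, d' (σ i) = d' i) (x : ∀ i, Fin (d' i)),
          ψ' (fun i => Fin.cast (hc i) (x (σ i))) = ψ' x) ∧
      winProb π V d' ψ' P' = p := by
  classical
  let K : Finset (Equiv.Perm (Fin N)) := {σ | ∀ i : Fin N, k ≤ (i : ℕ) → σ i = i}
  have hmem (σ : Equiv.Perm (Fin N)) : σ ∈ K ↔ ∀ i : Fin N, k ≤ (i : ℕ) → σ i = i := by
    simp [K]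
  have hK : (0 : ℝ) < #K :=
    Nat.cast_pos.2 (Finset.card_pos.2 ⟨1, (hmem 1).2 fun _ _ => rfl⟩)
  let e : Fin (∑ i, d i) ≃ Σ i, Fin (d i) := finSigmaFinEquiv.symm
  let c : ℂ := (((√(#K : ℝ))⁻¹ : ℝ) : ℂ)
  have hc : (starRingEnd ℂ) c * c = (((#K : ℝ)⁻¹ : ℝ) : ℂ) := by
    simp only [c, Complex.conj_ofReal, ← Complex.ofReal_mul]
    rw [← mul_inv, Real.mul_self_sqrt hK.le]
  let φ : (Fin N → Σ i, Fin (d i)) → ℂ := fun x => c * ∑ σ ∈ K, diagEmbed ψ (x ∘ σ)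
  have hform (M : Fin N → ∀ i, Matrix (Fin (d i)) (Fin (d i)) ℂ) :
      tensorForm (fun y : Fin N → Fin (∑ i, d i) => φ fun i => e (y i))
          (fun i => (blockDiagonal' (M i)).submatrix e e)
        = (((#K : ℝ)⁻¹ : ℝ) : ℂ) * ∑ σ ∈ K, tensorForm ψ fun i => M (σ i) i := by
    rw [tensorForm_submatrix e φ, tensorForm_symmetrize, hc]
    · congr 1
      refine Finset.sum_congr rfl fun σ _ => ?_
      rw [tensorForm_diagEmbed]
      congr 1
      ext i s t
      simp
    · rintro i ⟨s, s'⟩ ⟨t, t'⟩ h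
      exact blockDiagonal'_apply_ne _ _ _ h
  refine ⟨fun _ => ∑ i, d i, fun y => φ fun i => e (y i),
    fun _ q a => (blockDiagonal' fun j => P j q a).submatrix e e, ?_, ?_, ?_, ?_, ?_, ?_⟩
  · have h := hform fun _ _ => 1
    have h1 : (fun _ : Fin N => (blockDiagonal'
        (fun i => (1 : Matrix (Fin (d i)) (Fin (d i)) ℂ))).submatrix e e) = fun _ => 1 := by
      ext1 i
      rw [← submatrix_one_equiv e, ← blockDiagonal'_one]
      rfl
    rw [h1, tensorForm_one, tensorForm_one, hψ, Finset.sum_const, nsmul_eq_mul] at h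
    have h2 : (((#K : ℝ)⁻¹ : ℝ) : ℂ) * ((#K : ℂ) * ((1 : ℝ) : ℂ)) = ((1 : ℝ) : ℂ) := by
      rw [← Complex.ofReal_natCast, ← Complex.ofReal_mul, ← Complex.ofReal_mul, mul_one,
        inv_mul_cancel₀ hK.ne']
    exact Complex.ofReal_injective (h.trans h2)
  · exact fun _ q => IsProjMeas.submatrix_blockDiagonal' e fun i => hP i q
  · exact fun _ _ _ _ => rfl
  · exact fun _ _ _ _ _ _ _ => rfl
  · intro σ hσ _ x
    change c * ∑ τ ∈ K, diagEmbed ψ ((fun i => e (x (σ i))) ∘ τ)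
      = c * ∑ τ ∈ K, diagEmbed ψ ((fun i => e (x i)) ∘ τ)
    congr 1
    refine Finset.sum_equiv (Equiv.mulLeft σ) (fun τ => ?_) fun τ _ => rfl
    rw [hmem, hmem]
    refine forall₂_congr fun i hi => ?_
    rw [Equiv.coe_mulLeft, Equiv.Perm.mul_apply]
    exact ⟨fun h => by rw [h, hσ i hi], fun h => σ.injective (h.trans (hσ i hi).symm)⟩
  · let g (σ : Equiv.Perm (Fin N)) : ℝ := ∑ q, π q * ∑ a, (if V a q then (1 : ℝ) else 0) *
      (tensorForm ψ fun i => P i (q (σ i)) (a (σ i))).re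
    have hg (σ : Equiv.Perm (Fin N)) (hσ : σ ∈ K) : g σ = p := by
      rw [hmem] at hσ
      rw [← hp, winProb_eq]
      refine Fintype.sum_equiv (σ.symm.arrowCongr (Equiv.refl _)) _ _ fun q => ?_
      rw [arrowCongr_symm_refl_apply, hπsym σ hσ]
      congr 1
      refine Fintype.sum_equiv (σ.symm.arrowCongr (Equiv.refl _)) _ _ fun a => ?_
      rw [arrowCongr_symm_refl_apply, hVsym σ hσ]
      rfl
    have hsum : ∑ σ ∈ K, g σ = #K * p := by
      rw [Finset.sum_congr rfl hg, Finset.sum_const, nsmul_eq_mul]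
    have hp' : (#K : ℝ)⁻¹ * ∑ σ ∈ K, g σ = p := by
      rw [hsum, inv_mul_cancel_left₀ hK.ne']
    rw [winProb_eq, ← hp']
    simp only [hform fun i j => P j _ _, Complex.re_ofReal_mul, Complex.re_sum, g]
    simp only [Finset.mul_sum]
    symm
    rw [Finset.sum_comm]
    refine Finset.sum_congr rfl fun q _ => ?_
    rw [Finset.sum_comm]
    refine Finset.sum_congr rfl fun a _ => ?_
    refine Finset.sum_congr rfl fun σ _ => ?_
    ring
end
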